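/- In the setting of the deterministic correlation estimation bound — H a separable real Hilbert space, D, D̂ bounded positive operators with ‖D̂ − D‖₂ ≤ δ, Φ Hilbert–Schmidt, β > 0, R₀ = D^β Φ D^β, C₀ = D^{1/2} R₀ D^{1/2}, Ĉ₀ Hilbert–Schmidt with ‖Ĉ₀ − C₀‖₂ ≤ δ — assume additionally 0 < δ ≤ 1, set b := min(β, 1) and choose ε := δ^{1/(1+b)}. Then, with R̂₀ := (εI + D̂)^{−1/2} Ĉ₀ (εI + D̂)^{−1/2}, one has ‖R̂₀ − R₀‖₂ ≤ κ δ^{b/(1+b)}, where κ := 8 · max( 1 + ‖R₀‖₂ , ‖Φ‖₂ ‖D‖^{2β − b} ). -/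

import Mathlib

/-- `T` has Hilbert–Schmidt norm at most `c`. -/
def HSB {E : Type*} [NormedAddCommGroup E] [InnerProductSpace ℝ E]
    {ι : Type*} (e : ι → E) (T : E →L[ℝ] E) (c : ℝ) : Prop :=
  0 ≤ c ∧ ∀ s : Finset ι, ∑ i ∈ s, ‖T (e i)‖ ^ 2 ≤ c ^ 2

section HS
variable {E : Type*} [NormedAddCommGroup E] [InnerProductSpace ℝ E]
    {ι : Type*}

lemma HSB.of_summable {e : ι → E} {T : E →L[ℝ] E} {c : ℝ}
    (h : Summable fun i => ‖T (e i)‖ ^ 2) (hc : Real.sqrt (∑' i, ‖T (e i)‖ ^ 2) ≤ c) :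
    HSB e T c := by
  have hc0 := (Real.sqrt_nonneg _).trans hc
  refine ⟨hc0, fun s => ?_⟩
  exact (h.sum_le_tsum s (fun i _ => by positivity)).trans ((Real.sqrt_le_left hc0).1 hc)

lemma HSB.summable {e : ι → E} {T : E →L[ℝ] E} {c : ℝ} (h : HSB e T c) :
    Summable fun i => ‖T (e i)‖ ^ 2 :=
  summable_of_sum_le (fun i => by positivity) h.2

lemma HSB.tsum_le {e : ι → E} {T : E →L[ℝ] E} {c : ℝ} (h : HSB e T c) :
    ∑' i, ‖T (e i)‖ ^ 2 ≤ c ^ 2 :=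
  h.summable.tsum_le_of_sum_le h.2

lemma HSB.sqrt_le {e : ι → E} {T : E →L[ℝ] E} {c : ℝ} (h : HSB e T c) :
    Real.sqrt (∑' i, ‖T (e i)‖ ^ 2) ≤ c :=
  (Real.sqrt_le_left h.1).2 h.tsum_le

lemma HSB.mono {e : ι → E} {T : E →L[ℝ] E} {c d : ℝ} (h : HSB e T c) (hcd : c ≤ d) :
    HSB e T d :=
  ⟨h.1.trans hcd, fun s => (h.2 s).trans (by have := h.1; gcongr)⟩

lemma HSB.add {e : ι → E} {S T : E →L[ℝ] E} {c d : ℝ} (hS : HSB e S c) (hT : HSB e T d) :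
    HSB e (S + T) (c + d) := by
  refine ⟨add_nonneg hS.1 hT.1, fun s => ?_⟩
  have h1 : ∑ i ∈ s, ‖S (e i)‖ * ‖T (e i)‖ ≤ c * d := by
    refine (Real.sum_mul_le_sqrt_mul_sqrt s _ _).trans ?_
    exact mul_le_mul ((Real.sqrt_le_left hS.1).2 (hS.2 s)) ((Real.sqrt_le_left hT.1).2 (hT.2 s))
      (Real.sqrt_nonneg _) hS.1
  calc ∑ i ∈ s, ‖(S + T) (e i)‖ ^ 2
      ≤ ∑ i ∈ s, (‖S (e i)‖ ^ 2 + ‖T (e i)‖ ^ 2 + 2 * (‖S (e i)‖ * ‖T (e i)‖)) := by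
        refine Finset.sum_le_sum fun i _ => ?_
        have := norm_add_le (S (e i)) (T (e i))
        have h0 := norm_nonneg (S (e i) + T (e i))
        simp only [add_apply]
        nlinarith
    _ = _ := by rw [Finset.sum_add_distrib, Finset.sum_add_distrib, ← Finset.mul_sum]
    _ ≤ (c + d) ^ 2 := by nlinarith [hS.2 s, hT.2 s]

lemma HSB.mul_left {e : ι → E} {T : E →L[ℝ] E} {c a : ℝ} (hT : HSB e T c) (A : E →L[ℝ] E)
    (hA : ‖A‖ ≤ a) : HSB e (A * T) (a * c) := by
  have ha := (norm_nonneg A).trans hA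
  refine ⟨mul_nonneg ha hT.1, fun s => ?_⟩
  calc ∑ i ∈ s, ‖(A * T) (e i)‖ ^ 2 ≤ ∑ i ∈ s, a ^ 2 * ‖T (e i)‖ ^ 2 := by
        refine Finset.sum_le_sum fun i _ => ?_
        rw [← mul_pow]
        have := A.le_of_opNorm_le hA (T (e i))
        exact pow_le_pow_left₀ (norm_nonneg _) this 2
    _ = a ^ 2 * ∑ i ∈ s, ‖T (e i)‖ ^ 2 := by rw [Finset.mul_sum]
    _ ≤ (a * c) ^ 2 := by rw [mul_pow]; exact mul_le_mul_of_nonneg_left (hT.2 s) (sq_nonneg a)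

variable [CompleteSpace E]
open ContinuousLinearMap

lemma parseval (e : HilbertBasis ι ℝ E) (x : E) :
    HasSum (fun i => (inner ℝ (e i) x) ^ 2) (‖x‖ ^ 2) := by
  have := e.hasSum_inner_mul_inner x x
  rw [real_inner_self_eq_norm_sq] at this
  have h2 : (fun i => (inner ℝ (e i) x) ^ 2) = fun i => inner ℝ x (e i) * inner ℝ (e i) x := by
    funext i
    rw [real_inner_comm (e i) x, sq]
  rw [h2]
  exact this

lemma HSB.adj {e : HilbertBasis ι ℝ E} {T : E →L[ℝ] E} {c : ℝ} (h : HSB e T c) :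
    HSB e (star T) c := by
  refine ⟨h.1, fun s => ?_⟩
  have h1 : HasSum (fun j => ∑ i ∈ s, (inner ℝ (e j) ((star T) (e i))) ^ 2)
      (∑ i ∈ s, ‖(star T) (e i)‖ ^ 2) :=
    hasSum_sum fun i _ => parseval e _
  refine (hasSum_le (fun j => ?_) h1 h.summable.hasSum).trans h.tsum_le
  have := e.orthonormal.sum_inner_products_le (s := s) (T (e j))
  refine le_trans (le_of_eq ?_) this
  refine Finset.sum_congr rfl fun i _ => ?_
  rw [star_eq_adjoint, adjoint_inner_right, real_inner_comm, Real.norm_eq_abs, sq_abs]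

lemma HSB.mul_right {e : HilbertBasis ι ℝ E} {T : E →L[ℝ] E} {c a : ℝ} (hT : HSB e T c)
    (A : E →L[ℝ] E) (hA : ‖A‖ ≤ a) : HSB e (T * A) (c * a) := by
  have := (hT.adj.mul_left (a := a) (star A) ((norm_star A).le.trans hA)).adj
  rwa [star_mul, star_star, star_star, mul_comm a c] at this

lemma HSB.opNorm_le {e : HilbertBasis ι ℝ E} {T : E →L[ℝ] E} {c : ℝ} (hT : HSB e T c) :
    ‖T‖ ≤ c := by
  rw [← norm_star T]
  refine opNorm_le_bound _ hT.1 fun y => ?_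
  have h1 := parseval e ((star T) y)
  have : ‖(star T) y‖ ^ 2 ≤ (c * ‖y‖) ^ 2 := by
    calc ‖(star T) y‖ ^ 2 ≤ (∑' i, ‖T (e i)‖ ^ 2) * ‖y‖ ^ 2 := by
          refine hasSum_le (fun i => ?_) h1 (hT.summable.hasSum.mul_right _)
          rw [star_eq_adjoint, adjoint_inner_right, ← mul_pow, ← sq_abs]
          exact pow_le_pow_left₀ (abs_nonneg _) (abs_real_inner_le_norm _ _) 2
      _ ≤ _ := by rw [mul_pow]; exact mul_le_mul_of_nonneg_right hT.tsum_le (sq_nonneg _)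
  exact le_of_sq_le_sq this (mul_nonneg hT.1 (norm_nonneg y))
end HS

section Ops
variable {E : Type*} [NormedAddCommGroup E] [InnerProductSpace ℝ E] [CompleteSpace E]
open ContinuousLinearMap

lemma pos_symm {T : E →L[ℝ] E} (h : 0 ≤ T) (x y : E) : inner ℝ (T x) y = inner ℝ x (T y) :=
  ((nonneg_iff_isPositive T).1 h).inner_left_eq_inner_right x y

lemma pos_nonneg {T : E →L[ℝ] E} (h : 0 ≤ T) (x : E) : 0 ≤ inner ℝ (T x) x :=
  ((nonneg_iff_isPositive T).1 h).inner_nonneg_left x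

lemma cmul (A B : E →L[ℝ] E) (x : E) : (A * B) x = A (B x) := rfl

lemma sylv {P Q : E →L[ℝ] E} (hP : ∀ x y, inner ℝ (P x) y = inner ℝ x (P y))
    (hQ : ∀ x y, inner ℝ (Q x) y = inner ℝ x (Q y)) {m d : ℝ} (hm : 0 < m)
    (hPm : ∀ x, m * ‖x‖ ^ 2 ≤ inner ℝ (P x) x) (hQm : ∀ x, m * ‖x‖ ^ 2 ≤ inner ℝ (Q x) x)
    (hd : ‖P * P - Q * Q‖ ≤ d) : ‖P - Q‖ ≤ d / (2 * m) := by
  by_contra hcon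
  push Not at hcon
  obtain ⟨A, hA⟩ : ∃ A, A = P - Q := ⟨_, rfl⟩
  obtain ⟨S, hS⟩ : ∃ S, S = P + Q := ⟨_, rfl⟩
  rw [← hA] at hcon
  set M := ‖A‖ with hM
  have hd0 : 0 ≤ d := (norm_nonneg _).trans hd
  have hMpos : 0 < M := lt_of_le_of_lt (by positivity) hcon
  have hg : 0 < 2 * m * M - d := by
    rw [div_lt_iff₀ (by positivity)] at hcon
    linarith
  set g := 2 * m * M - d with hgdef
  set K := ‖S‖ + 1 with hK
  have hKpos : 0 < K := by positivity
  have hAs : ∀ x y, inner ℝ (A x) y = inner ℝ x (A y) := by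
    intro x y; simp [hA, inner_sub_left, inner_sub_right, hP, hQ]
  have hSm : ∀ y, 2 * m * ‖y‖ ^ 2 ≤ inner ℝ (S y) y := by
    intro y
    have h1 := hPm y
    have h2 := hQm y
    simp only [hS, add_apply, inner_add_left]
    linarith
  -- the Sylvester identity
  have hid : ∀ y, inner ℝ (A y) (S y) = inner ℝ y ((P * P - Q * Q) y) := by
    intro y
    simp only [hA, hS, sub_apply, add_apply, cmul, inner_sub_left, inner_add_right,
      inner_sub_right]
    rw [← hP y (P y), ← hQ y (Q y), real_inner_comm (P y) (Q y)]
    ring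
  have hDel : ∀ y, |inner ℝ y ((P * P - Q * Q) y)| ≤ d * ‖y‖ ^ 2 := by
    intro y
    calc _ ≤ ‖y‖ * ‖(P * P - Q * Q) y‖ := abs_real_inner_le_norm _ _
      _ ≤ ‖y‖ * (d * ‖y‖) := by gcongr; exact le_of_opNorm_le _ hd y
      _ = _ := by ring
  have key : ∀ (l : ℝ) (y z : E), |l| = M → A y = l • y + z → g * ‖y‖ ≤ K * ‖z‖ := by
    intro l y z hl hy
    have h1 := hid y
    rw [hy, inner_add_left, inner_smul_left] at h1
    simp only [conj_trivial] at h1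
    have h2 : |inner ℝ z (S y)| ≤ ‖z‖ * (K * ‖y‖) := by
      refine (abs_real_inner_le_norm _ _).trans ?_
      gcongr
      exact le_of_opNorm_le _ (by rw [hK]; linarith) y
    have h3 := hSm y
    rw [real_inner_comm] at h3
    have h4 : M * inner ℝ y (S y) = |l * inner ℝ y (S y)| := by
      rw [abs_mul, hl, abs_of_nonneg (a := inner ℝ y (S y)) (le_trans (by positivity) h3)]
    have h5 : |l * inner ℝ y (S y)| ≤ d * ‖y‖ ^ 2 + ‖z‖ * (K * ‖y‖) := by
      have : l * inner ℝ y (S y) = inner ℝ y ((P * P - Q * Q) y) - inner ℝ z (S y) := by linarith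
      rw [this]
      exact (abs_sub _ _).trans (add_le_add (hDel y) h2)
    have h6 : M * (2 * m * ‖y‖ ^ 2) ≤ d * ‖y‖ ^ 2 + ‖z‖ * (K * ‖y‖) := by
      rw [← h4] at h5
      exact (mul_le_mul_of_nonneg_left h3 hMpos.le).trans h5
    rcases (norm_nonneg y).eq_or_lt with h0 | h0
    · rw [← h0]; simp; positivity
    · refine le_of_mul_le_mul_right ?_ h0
      rw [hgdef]; nlinarith
  have hfin : ∀ x, g ^ 2 * ‖x‖ ^ 2 ≤ K ^ 2 * (M ^ 2 * ‖x‖ ^ 2 - ‖A x‖ ^ 2) := by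
    intro x
    set z := A (A x) - M ^ 2 • x with hz
    have k1 := key M (A x + M • x) z (abs_of_pos hMpos) (by
      rw [hz, map_add, map_smul, smul_add, smul_smul, sq]; abel)
    have k2 := key (-M) (M • x - A x) (-z) (by rw [abs_neg, abs_of_pos hMpos]) (by
      rw [hz, map_sub, map_smul, smul_sub, smul_smul, neg_smul, neg_mul, neg_smul, sq]; abel)
    rw [norm_neg] at k2
    have k3 : 2 * M * ‖x‖ ≤ ‖A x + M • x‖ + ‖M • x - A x‖ := by
      have : (A x + M • x) + (M • x - A x) = (2 * M) • x := by
        rw [mul_smul, two_smul]; abel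
      have h := norm_add_le (A x + M • x) (M • x - A x)
      rw [this, norm_smul, Real.norm_eq_abs, abs_of_pos (by positivity)] at h
      exact h
    have k4 : g * M * ‖x‖ ≤ K * ‖z‖ := by
      have := mul_le_mul_of_nonneg_left k3 hg.le
      nlinarith
    have hz2 : ‖z‖ ^ 2 ≤ M ^ 2 * (M ^ 2 * ‖x‖ ^ 2 - ‖A x‖ ^ 2) := by
      have e1 : ‖z‖ ^ 2 = ‖A (A x)‖ ^ 2 - 2 * (M ^ 2 * ‖A x‖ ^ 2) + (M ^ 2) ^ 2 * ‖x‖ ^ 2 := by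
        rw [hz, norm_sub_sq_real, inner_smul_right, hAs, real_inner_self_eq_norm_sq, norm_smul,
          mul_pow, Real.norm_eq_abs, sq_abs] 
      have e2 : ‖A (A x)‖ ^ 2 ≤ M ^ 2 * ‖A x‖ ^ 2 := by
        rw [← mul_pow]; exact pow_le_pow_left₀ (norm_nonneg _) (A.le_opNorm _) 2
      rw [e1]; nlinarith
    have k5 : (g * M * ‖x‖) ^ 2 ≤ (K * ‖z‖) ^ 2 := pow_le_pow_left₀ (by positivity) k4 2
    have k6 : M ^ 2 * (g ^ 2 * ‖x‖ ^ 2) ≤ M ^ 2 * (K ^ 2 * (M ^ 2 * ‖x‖ ^ 2 - ‖A x‖ ^ 2)) := by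
      calc _ = (g * M * ‖x‖) ^ 2 := by ring
        _ ≤ K ^ 2 * ‖z‖ ^ 2 := by rw [← mul_pow]; exact k5
        _ ≤ K ^ 2 * (M ^ 2 * (M ^ 2 * ‖x‖ ^ 2 - ‖A x‖ ^ 2)) := by gcongr
        _ = _ := by ring
    exact le_of_mul_le_mul_left k6 (by positivity)
  have hb : ∀ x, ‖A x‖ ^ 2 ≤ (M ^ 2 - g ^ 2 / K ^ 2) * ‖x‖ ^ 2 := by
    intro x
    have := hfin x
    have h2 : g ^ 2 / K ^ 2 * ‖x‖ ^ 2 ≤ M ^ 2 * ‖x‖ ^ 2 - ‖A x‖ ^ 2 := by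
      rw [div_mul_eq_mul_div, div_le_iff₀ (by positivity)]; linarith
    linarith
  have hlt : Real.sqrt (M ^ 2 - g ^ 2 / K ^ 2) < M := by
    rw [Real.sqrt_lt' hMpos]
    have : 0 < g ^ 2 / K ^ 2 := by positivity
    linarith
  have : ‖A‖ ≤ Real.sqrt (M ^ 2 - g ^ 2 / K ^ 2) := by
    refine opNorm_le_bound _ (Real.sqrt_nonneg _) fun x => ?_
    rw [← Real.sqrt_sq (norm_nonneg x), ← Real.sqrt_mul' _ (sq_nonneg _)]
    exact Real.le_sqrt_of_sq_le (hb x)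
  linarith

lemma root_facts {Q T : E →L[ℝ] E} {ε : ℝ} (hε : 0 < ε) (hQ : 0 ≤ Q) (hT : 0 ≤ T)
    (h : Q * Q = ε • (1 : E →L[ℝ] E) + T) :
    IsUnit Q ∧ ‖Ring.inverse Q‖ ≤ 1 / Real.sqrt ε ∧
      ∀ x, Real.sqrt ε * ‖x‖ ^ 2 ≤ inner ℝ (Q x) x := by
  have hs : 0 < Real.sqrt ε := Real.sqrt_pos.2 hε
  have h1 : ∀ x, inner ℝ ((Q * Q) x) x = ‖Q x‖ ^ 2 := by
    intro x; rw [cmul, pos_symm hQ, real_inner_self_eq_norm_sq]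
  have h2 : ∀ x, ε * ‖x‖ ^ 2 ≤ ‖Q x‖ ^ 2 := by
    intro x
    rw [← h1, h]
    have := pos_nonneg hT x
    simp only [add_apply, smul_apply, one_apply_eq_self, inner_add_left, inner_smul_left,
      conj_trivial, real_inner_self_eq_norm_sq]
    linarith
  have hu2 : IsUnit (Q * Q) := by
    refine isUnit_of_forall_le_norm_inner_map _ (c := ⟨ε, hε.le⟩) hε fun x => ?_
    rw [h1, Real.norm_eq_abs, abs_of_nonneg (by positivity)]
    have := h2 x
    rw [mul_comm]; exact this
  have hu : IsUnit Q := ((Commute.refl Q).isUnit_mul_iff.1 hu2).1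
  have hinv : ∀ x, Q ((Ring.inverse Q) x) = x := by
    intro x
    rw [← cmul, Ring.mul_inverse_cancel Q hu, one_apply_eq_self]
  have h3 : ∀ x, Real.sqrt ε * ‖x‖ ≤ ‖Q x‖ := by
    intro x
    refine le_of_sq_le_sq ?_ (norm_nonneg _)
    rw [mul_pow, Real.sq_sqrt hε.le]; exact h2 x
  have h4 : ∀ x, ‖(Ring.inverse Q) x‖ ≤ 1 / Real.sqrt ε * ‖x‖ := by
    intro x
    have := h3 ((Ring.inverse Q) x)
    rw [hinv] at this
    rw [div_mul_eq_mul_div, le_div_iff₀ hs]; linarith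
  refine ⟨hu, opNorm_le_bound _ (by positivity) h4, fun x => ?_⟩
  set s := Real.sqrt ε
  set y := (Ring.inverse Q) x with hy
  have h5 := pos_nonneg hQ (x - s • y)
  have h6 : inner ℝ (Q (x - s • y)) (x - s • y)
      = inner ℝ (Q x) x - 2 * s * ‖x‖ ^ 2 + s ^ 2 * inner ℝ x y := by
    rw [map_sub, map_smul, hinv]
    simp only [inner_sub_left, inner_sub_right, inner_smul_left, inner_smul_right, conj_trivial]
    rw [pos_symm hQ x y, hinv, real_inner_self_eq_norm_sq]
    ring
  have h7 : inner ℝ x y ≤ ‖x‖ ^ 2 / s := by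
    refine (real_inner_le_norm _ _).trans ?_
    calc ‖x‖ * ‖y‖ ≤ ‖x‖ * (1 / s * ‖x‖) := by gcongr; exact h4 x
      _ = _ := by ring
  have h8 : s ^ 2 * inner ℝ x y ≤ s * ‖x‖ ^ 2 := by
    calc _ ≤ s ^ 2 * (‖x‖ ^ 2 / s) := by gcongr
      _ = _ := by field_simp
  linarith

lemma fix_exists {B : E →L[ℝ] E} (hB : IsSelfAdjoint B) {ρ : ℝ} (hBρ : ‖B‖ ≤ ρ) (hρ : ρ < 1) :
    ∃ Y : E →L[ℝ] E, IsSelfAdjoint Y ∧ ‖Y‖ ≤ ρ ∧ (∀ Z, Commute Z B → Commute Z Y) ∧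
      (1 - Y) * (1 - Y) = 1 - B := by
  have hρ0 : 0 ≤ ρ := (norm_nonneg _).trans hBρ
  let s : Set (E →L[ℝ] E) := {Y | star Y = Y ∧ ‖Y‖ ≤ ρ ∧ ∀ Z, Commute Z B → Z * Y = Y * Z}
  let f : (E →L[ℝ] E) → (E →L[ℝ] E) := fun Y => (1 / 2 : ℝ) • (B + Y * Y)
  have hsc : IsClosed s := by
    have e1 : IsClosed {Y : E →L[ℝ] E | star Y = Y} := isClosed_eq continuous_star continuous_id
    have e2 : IsClosed {Y : E →L[ℝ] E | ‖Y‖ ≤ ρ} := isClosed_le continuous_norm continuous_const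
    have e3 : IsClosed {Y : E →L[ℝ] E | ∀ Z, Commute Z B → Z * Y = Y * Z} := by
      simp only [Set.ofPred_forall]
      refine isClosed_iInter fun Z => isClosed_iInter fun _ => ?_
      exact isClosed_eq (continuous_const.mul continuous_id) (continuous_id.mul continuous_const)
    exact e1.inter (e2.inter e3)
  have hmaps : Set.MapsTo f s s := by
    rintro Y ⟨h1, h2, h3⟩
    refine ⟨?_, ?_, fun Z hZ => ?_⟩
    · simp only [f, star_smul, star_add, star_mul, h1, hB.star_eq, star_trivial]
    · calc ‖f Y‖ ≤ (1 / 2) * (ρ + ρ * ρ) := by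
            simp only [f]
            rw [norm_smul, Real.norm_eq_abs, abs_of_pos (by norm_num : (0:ℝ) < 1 / 2)]
            gcongr
            refine (norm_add_le _ _).trans (add_le_add hBρ ((norm_mul_le _ _).trans ?_))
            gcongr
        _ ≤ ρ := by nlinarith
    · simp only [f]
      have hc : Commute Z Y := h3 Z hZ
      exact ((hZ.add_right (hc.mul_right hc)).smul_right (1 / 2 : ℝ))
  have hcontr : ContractingWith ⟨ρ, hρ0⟩ (hmaps.restrict f s s) := by
    refine ⟨hρ, LipschitzWith.of_dist_le_mul fun Y Z => ?_⟩
    obtain ⟨Y, hY⟩ := Y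
    obtain ⟨Z, hZ⟩ := Z
    change dist (f Y) (f Z) ≤ ρ * dist Y Z
    rw [dist_eq_norm, dist_eq_norm]
    have : f Y - f Z = (1 / 2 : ℝ) • (Y * (Y - Z) + (Y - Z) * Z) := by
      simp only [f]; rw [← smul_sub]; congr 1; noncomm_ring
    rw [this, norm_smul, Real.norm_eq_abs, abs_of_pos (by norm_num : (0:ℝ) < 1 / 2)]
    have a1 : ‖Y * (Y - Z)‖ ≤ ρ * ‖Y - Z‖ :=
      (norm_mul_le _ _).trans (mul_le_mul_of_nonneg_right hY.2.1 (norm_nonneg _))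
    have a2 : ‖(Y - Z) * Z‖ ≤ ‖Y - Z‖ * ρ :=
      (norm_mul_le _ _).trans (mul_le_mul_of_nonneg_left hZ.2.1 (norm_nonneg _))
    have := norm_add_le (Y * (Y - Z)) ((Y - Z) * Z)
    linarith
  have h0 : (0 : E →L[ℝ] E) ∈ s := ⟨star_zero _, by simpa using hρ0, fun Z _ => by simp⟩
  obtain ⟨Y, ⟨h1, h2, h3⟩, hfix, -⟩ :=
    hcontr.exists_fixedPoint' hsc.isComplete hmaps h0 (edist_ne_top _ _)
  refine ⟨Y, h1, h2, h3, ?_⟩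
  have hf : (1 / 2 : ℝ) • (B + Y * Y) = Y := hfix
  have : B + Y * Y = Y + Y := by
    have := congrArg (fun W => (2 : ℝ) • W) hf
    simpa [smul_smul, two_smul] using this
  calc (1 - Y) * (1 - Y) = 1 - (Y + Y) + Y * Y := by noncomm_ring
    _ = _ := by rw [← this]; abel

lemma root_exists {G : E →L[ℝ] E} (hG : 0 ≤ G) {ε : ℝ} (hε : 0 < ε) :
    ∃ P : E →L[ℝ] E, 0 ≤ P ∧ P * P = ε • (1 : E →L[ℝ] E) + G * G ∧
      ∀ Z, Commute Z (G * G) → Commute Z P := by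
  obtain ⟨M, hM⟩ : ∃ M, M = ‖G‖ ^ 2 := ⟨_, rfl⟩
  have hM0 : 0 ≤ M := by rw [hM]; positivity
  have hGs : IsSelfAdjoint G := ((nonneg_iff_isPositive G).1 hG).isSelfAdjoint
  have hGG : IsSelfAdjoint (G * G) := by
    rw [isSelfAdjoint_iff, star_mul, hGs.star_eq]
  obtain ⟨k, hk⟩ : ∃ k, k = M + ε := ⟨_, rfl⟩
  have hk0 : 0 < k := by linarith
  have hB0 : ‖M • (1 : E →L[ℝ] E) - G * G‖ ≤ M := by
    refine opNorm_le_bound _ hM0 fun x => ?_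
    refine le_of_sq_le_sq ?_ (by positivity)
    have e1 : (M • (1 : E →L[ℝ] E) - G * G) x = M • x - G (G x) := by simp
    rw [e1, norm_sub_sq_real, inner_smul_left, ← pos_symm hG, real_inner_self_eq_norm_sq, norm_smul,
      Real.norm_eq_abs, abs_of_nonneg hM0]
    simp only [conj_trivial]
    have e2 : ‖G (G x)‖ ^ 2 ≤ M * ‖G x‖ ^ 2 := by
      rw [hM, ← mul_pow]; exact pow_le_pow_left₀ (norm_nonneg _) (G.le_opNorm _) 2
    nlinarith [mul_nonneg hM0 (sq_nonneg ‖G x‖)]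
  have hBn : ‖k⁻¹ • (M • (1 : E →L[ℝ] E) - G * G)‖ ≤ k⁻¹ * M := by
    rw [norm_smul, Real.norm_eq_abs, abs_of_pos (by positivity)]
    gcongr
  have hBs : IsSelfAdjoint (k⁻¹ • (M • (1 : E →L[ℝ] E) - G * G)) := by
    rw [isSelfAdjoint_iff]
    simp [hGs.star_eq]
  obtain ⟨Y, h1, h2, h3, h4⟩ := fix_exists hBs hBn (by
    rw [inv_mul_lt_iff₀ hk0]; linarith)
  have h2' : ‖Y‖ ≤ 1 := h2.trans (by rw [inv_mul_le_iff₀ hk0]; linarith)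
  refine ⟨Real.sqrt k • (1 - Y), ?_, ?_, fun Z hZ => ?_⟩
  · rw [nonneg_iff_isPositive, isPositive_def']
    refine ⟨?_, fun x => ?_⟩
    · rw [isSelfAdjoint_iff]; simp [h1.star_eq]
    · rw [reApplyInnerSelf_apply]
      simp only [smul_apply, sub_apply, one_apply_eq_self, inner_smul_left, inner_sub_left,
        conj_trivial, RCLike.re_to_real, real_inner_self_eq_norm_sq]
      refine mul_nonneg (Real.sqrt_nonneg _) ?_
      have : inner ℝ (Y x) x ≤ ‖x‖ ^ 2 := by
        refine (real_inner_le_norm _ _).trans ?_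
        have := Y.le_of_opNorm_le h2' x
        nlinarith [norm_nonneg x]
      linarith
  · rw [smul_mul_smul_comm, Real.mul_self_sqrt hk0.le, h4, smul_sub, smul_smul,
      mul_inv_cancel₀ hk0.ne', one_smul, hk, add_smul]
    abel
  · refine Commute.smul_right (Commute.sub_right (Commute.one_right Z) (h3 Z ?_)) _
    exact Commute.smul_right (Commute.sub_right (Commute.smul_right (Commute.one_right Z) _) hZ) _

lemma pow_bound {Dpow : ℝ → E →L[ℝ] E}
    (hpos : ∀ r, 0 < r → 0 ≤ Dpow r)
    (hadd : ∀ s t, 0 < s → 0 < t → Dpow (s + t) = Dpow s * Dpow t)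
    (hcont : ∀ x : E, ContinuousOn (fun r : ℝ => Dpow r x) (Set.Ioi (0 : ℝ)))
    {c M : ℝ} (hc : 0 < c) (hM : 0 ≤ M) {w : E} (hw : ‖w‖ ≤ M) (hw1 : ‖Dpow 1 w‖ ≤ c * M)
    {r : ℝ} (hr0 : 0 < r) (hr1 : r ≤ 1) : ‖Dpow r w‖ ≤ c ^ r * M := by
  let p : ℝ → E := fun r => if r = 0 then w else Dpow r w
  have p0 : p 0 = w := by simp [p]
  have pp : ∀ r, 0 < r → p r = Dpow r w := fun r hr => by simp [p, hr.ne']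
  have mid : ∀ s, 0 ≤ s → ∀ t, 0 < t → ‖p ((s + t) / 2)‖ ^ 2 ≤ ‖p s‖ * ‖p t‖ := by
    intro s hs t ht
    rw [pp _ (by positivity), pp t ht, ← real_inner_self_eq_norm_sq, pos_symm (hpos _ (by positivity)),
      ← cmul, ← hadd _ _ (by positivity) (by positivity), add_halves]
    rcases hs.eq_or_lt with rfl | hs
    · rw [p0, zero_add]; exact real_inner_le_norm _ _
    · rw [pp s hs, hadd s t hs ht, cmul, ← pos_symm (hpos s hs)]
      exact real_inner_le_norm _ _
  have dy : ∀ n k : ℕ, k ≤ 2 ^ n → ‖p (k / 2 ^ n)‖ ≤ c ^ ((k : ℝ) / 2 ^ n) * M := by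
    intro n
    induction n with
    | zero =>
      intro k hk
      have : k = 0 ∨ k = 1 := by simp at hk; omega
      rcases this with rfl | rfl
      · simpa [p0] using hw
      · simpa [p] using hw1
    | succ n ih =>
      intro k hk
      rcases Nat.even_or_odd' k with ⟨j, rfl | rfl⟩
      · have : ((2 * j : ℕ) : ℝ) / 2 ^ (n + 1) = j / 2 ^ n := by
          push_cast; rw [pow_succ]; field_simp
        rw [this]
        exact ih j (by rw [pow_succ] at hk; omega)
      · have hj : j + 1 ≤ 2 ^ n := by rw [pow_succ] at hk; omega
        have e1 : ((2 * j + 1 : ℕ) : ℝ) / 2 ^ (n + 1)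
            = ((j : ℝ) / 2 ^ n + ((j + 1 : ℕ) : ℝ) / 2 ^ n) / 2 := by
          push_cast; field_simp; ring
        have i1 := ih j (by omega)
        have i2 := ih (j + 1) hj
        rw [e1]
        set s := (j : ℝ) / 2 ^ n
        have ht0 : 0 < ((j + 1 : ℕ) : ℝ) / 2 ^ n := by positivity
        set t := ((j + 1 : ℕ) : ℝ) / 2 ^ n
        have := mid s (by positivity) t ht0
        refine le_of_sq_le_sq (this.trans ?_) (by positivity)
        calc ‖p s‖ * ‖p t‖ ≤ (c ^ s * M) * (c ^ t * M) := by gcongr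
          _ = (c ^ ((s + t) / 2) * M) ^ 2 := by
            rw [mul_pow, ← Real.rpow_natCast (c ^ ((s + t) / 2)), ← Real.rpow_mul hc.le]
            rw [show (s + t) / 2 * ((2 : ℕ) : ℝ) = s + t by push_cast; ring, Real.rpow_add hc]
            ring
  have lim : Filter.Tendsto (fun n : ℕ => (⌊r * 2 ^ n⌋₊ : ℝ) / 2 ^ n) Filter.atTop (nhds r) :=
    (tendsto_nat_floor_mul_div_atTop hr0.le).comp
      (tendsto_pow_atTop_atTop_of_one_lt (by norm_num : (1 : ℝ) < 2))
  have hcr : ContinuousAt (fun r : ℝ => Dpow r w) r :=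
    (hcont w).continuousAt (Ioi_mem_nhds hr0)
  have l1 := (hcr.norm.tendsto).comp lim
  have l2 : Filter.Tendsto (fun n : ℕ => c ^ ((⌊r * 2 ^ n⌋₊ : ℝ) / 2 ^ n) * M) Filter.atTop
      (nhds (c ^ r * M)) :=
    ((Real.continuous_const_rpow hc.ne').tendsto r |>.comp lim).mul_const M
  refine le_of_tendsto_of_tendsto l1 l2 ?_
  filter_upwards [lim.eventually (Ioi_mem_nhds hr0)] with n hn
  have hk : ⌊r * 2 ^ n⌋₊ ≤ 2 ^ n := by
    refine Nat.floor_le_of_le ?_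
    push_cast
    have : (0 : ℝ) < 2 ^ n := by positivity
    nlinarith
  have := dy n _ hk
  rw [pp _ hn] at this
  exact this

lemma pow_norm {Dpow : ℝ → E →L[ℝ] E}
    (hpos : ∀ r, 0 < r → 0 ≤ Dpow r)
    (hadd : ∀ s t, 0 < s → 0 < t → Dpow (s + t) = Dpow s * Dpow t)
    (hcont : ∀ x : E, ContinuousOn (fun r : ℝ => Dpow r x) (Set.Ioi (0 : ℝ)))
    {r : ℝ} (hr0 : 0 < r) : ‖Dpow r‖ ≤ ‖Dpow 1‖ ^ r := by
  have small : ∀ r, 0 < r → r ≤ 1 → ‖Dpow r‖ ≤ ‖Dpow 1‖ ^ r := by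
    intro r hr hr1
    have h1 : ∀ c, ‖Dpow 1‖ < c → ‖Dpow r‖ ≤ c ^ r := by
      intro c hc
      have hc0 := (norm_nonneg _).trans_lt hc
      refine opNorm_le_bound _ (by positivity) fun x => ?_
      exact pow_bound hpos hadd hcont hc0 (norm_nonneg x) le_rfl
        (le_of_opNorm_le _ hc.le x) hr hr1
    have l : Filter.Tendsto (fun c : ℝ => c ^ r) (nhdsWithin ‖Dpow 1‖ (Set.Ioi ‖Dpow 1‖))
        (nhds (‖Dpow 1‖ ^ r)) :=
      ((Real.continuousAt_rpow_const _ _ (Or.inr hr.le)).tendsto).mono_left nhdsWithin_le_nhds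
    refine ge_of_tendsto l ?_
    filter_upwards [self_mem_nhdsWithin] with c hc using h1 c hc
  have mulN : ∀ s, 0 < s → ∀ n : ℕ, ‖Dpow ((n + 1 : ℕ) * s)‖ ≤ ‖Dpow s‖ ^ (n + 1) := by
    intro s hs n
    induction n with
    | zero => simp
    | succ n ih =>
      rw [show ((n + 1 + 1 : ℕ) : ℝ) * s = (n + 1 : ℕ) * s + s by push_cast; ring,
        hadd _ _ (by positivity) hs, pow_succ]
      exact (norm_mul_le _ _).trans (mul_le_mul_of_nonneg_right ih (norm_nonneg _))
  obtain ⟨n, hn⟩ := exists_nat_ge r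
  have hn1 : (0 : ℝ) < (n + 1 : ℕ) := by positivity
  have h2 := mulN (r / (n + 1 : ℕ)) (by positivity) n
  rw [mul_div_cancel₀ _ hn1.ne'] at h2
  refine h2.trans ?_
  calc _ ≤ (‖Dpow 1‖ ^ (r / (n + 1 : ℕ))) ^ (n + 1) := by
        gcongr
        refine small _ (by positivity) ?_
        rw [div_le_one hn1]; push_cast; linarith
    _ = _ := by
        rw [← Real.rpow_natCast, ← Real.rpow_mul (norm_nonneg _), div_mul_cancel₀ _ hn1.ne']
end Ops

section Approx
variable {E : Type*} [NormedAddCommGroup E] [InnerProductSpace ℝ E] [CompleteSpace E]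
open ContinuousLinearMap

lemma approx_bound {Dpow : ℝ → E →L[ℝ] E}
    (hpos : ∀ r, 0 < r → 0 ≤ Dpow r)
    (hadd : ∀ s t, 0 < s → 0 < t → Dpow (s + t) = Dpow s * Dpow t)
    (hcont : ∀ x : E, ContinuousOn (fun r : ℝ => Dpow r x) (Set.Ioi (0 : ℝ)))
    {ε : ℝ} (hε : 0 < ε) {P : E →L[ℝ] E} (hP : 0 ≤ P) (hPu : IsUnit P)
    (hPP : P * P = ε • (1 : E →L[ℝ] E) + Dpow 1)
    (hPc : ∀ r, 0 < r → Commute (Dpow r) P)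
    {b β : ℝ} (hb : 0 < b) (hb1 : b ≤ 1) (hbβ : b ≤ β) :
    ‖(Ring.inverse P * Dpow (1 / 2) - 1) * Dpow β‖ ≤ ε ^ b * ‖Dpow 1‖ ^ (β - b) := by
  set Pi := Ring.inverse P with hPi
  have hr : ∀ x, P (Pi x) = x := fun x => by
    rw [← cmul, Ring.mul_inverse_cancel P hPu, one_apply_eq_self]
  have hl : ∀ x, Pi (P x) = x := fun x => by
    rw [← cmul, Ring.inverse_mul_cancel P hPu, one_apply_eq_self]
  have hc : ∀ r, 0 < r → ∀ x, Dpow r (P x) = P (Dpow r x) := fun r hr x => by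
    rw [← cmul, (hPc r hr).eq, cmul]
  have hhalf : (0 : ℝ) < 1 / 2 := by norm_num
  set G := Dpow (1 / 2) with hG
  have hGG : G * G = Dpow 1 := by rw [hG, ← hadd _ _ hhalf hhalf]; norm_num
  -- the product `P G` is positive
  have hPG : ∀ z, 0 ≤ inner ℝ (P z) (G z) := by
    intro z
    have hq : (0 : ℝ) < 1 / 4 := by norm_num
    have e1 : G = Dpow (1 / 4) * Dpow (1 / 4) := by rw [hG, ← hadd _ _ hq hq]; norm_num
    rw [e1, cmul, ← pos_symm (hpos _ hq), hc _ hq]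
    exact pos_nonneg hP _
  have hPle : ∀ z, ‖P z‖ ≤ ‖P z + G z‖ := by
    intro z
    refine le_of_sq_le_sq ?_ (norm_nonneg _)
    rw [norm_add_sq_real]
    have := hPG z
    have := sq_nonneg ‖G z‖
    linarith
  refine opNorm_le_bound _ (by positivity) fun x => ?_
  obtain ⟨v, hv1, hv2⟩ : ∃ v, ‖v‖ ≤ ‖Dpow 1‖ ^ (β - b) * ‖x‖ ∧ Dpow β x = Dpow b v := by
    rcases hbβ.eq_or_lt with h | h
    · exact ⟨x, by simp [h], by rw [h]⟩
    · refine ⟨Dpow (β - b) x, le_of_opNorm_le _ (pow_norm hpos hadd hcont (sub_pos.2 h)) x, ?_⟩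
      rw [← cmul, ← hadd _ _ hb (sub_pos.2 h)]
      congr 2; ring
  set w := Pi (Pi v) with hw
  have hvw : P (P w) = v := by rw [hw, hr, hr]
  have hvw' : v = ε • w + Dpow 1 w := by
    rw [← hvw, ← cmul, hPP]; simp
  set u := Dpow b w with hu
  have hDu : Dpow b v = P (P u) := by rw [← hvw, hc b hb, hc b hb]
  have e1 : ((Pi * G - 1) * Dpow β) x = -(P (P u - G u)) := by
    rw [cmul, hv2, hDu, sub_apply, cmul, hG, hc _ hhalf, hl, hc _ hhalf, one_apply_eq_self, map_sub]
    abel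
  have e2 : ‖P (P u - G u)‖ ≤ ε * ‖u‖ := by
    refine (hPle _).trans (le_of_eq ?_)
    have : P (P u - G u) + G (P u - G u) = ε • u := by
      have h1 : P (P u) = ε • u + G (G u) := by
        rw [← cmul, hPP, ← hGG]; simp
      rw [map_sub, map_sub, h1, hG, hc _ hhalf]; abel
    rw [this, norm_smul, Real.norm_eq_abs, abs_of_pos hε]
  have hsq : ‖v‖ ^ 2 = ε ^ 2 * ‖w‖ ^ 2 + 2 * (ε * inner ℝ (Dpow 1 w) w) + ‖Dpow 1 w‖ ^ 2 := by
    rw [hvw', norm_add_sq_real, norm_smul, inner_smul_left, real_inner_comm, mul_pow,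
      Real.norm_eq_abs, sq_abs]
    simp
  have hnn := mul_nonneg hε.le (pos_nonneg (hpos 1 one_pos) w)
  have hw0 : ‖w‖ ≤ ‖v‖ / ε := by
    rw [le_div_iff₀ hε]
    refine le_of_sq_le_sq ?_ (norm_nonneg _)
    rw [hsq, mul_pow]; nlinarith [sq_nonneg ‖Dpow 1 w‖]
  have hw1 : ‖Dpow 1 w‖ ≤ ε * (‖v‖ / ε) := by
    rw [mul_div_cancel₀ _ hε.ne']
    refine le_of_sq_le_sq ?_ (norm_nonneg _)
    rw [hsq]; nlinarith [mul_nonneg (sq_nonneg ε) (sq_nonneg ‖w‖)]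
  have e3 := pow_bound hpos hadd hcont hε (by positivity) hw0 hw1 hb hb1
  rw [e1, norm_neg]
  calc _ ≤ ε * ‖u‖ := e2
    _ ≤ ε * (ε ^ b * (‖v‖ / ε)) := by gcongr
    _ = ε ^ b * ‖v‖ := by field_simp
    _ ≤ ε ^ b * (‖Dpow 1‖ ^ (β - b) * ‖x‖) := by gcongr
    _ = _ := by ring

lemma half_bound {G P T : E →L[ℝ] E} (hG : 0 ≤ G) (hP : 0 ≤ P) (hPu : IsUnit P) {ε : ℝ}
    (hε : 0 < ε) (hGG : G * G = T) (hPP : P * P = ε • (1 : E →L[ℝ] E) + T) :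
    ‖G * Ring.inverse P‖ ≤ 1 := by
  refine opNorm_le_bound _ zero_le_one fun x => ?_
  set y := (Ring.inverse P) x with hy
  have hx : x = P y := by
    rw [hy, ← cmul, Ring.mul_inverse_cancel P hPu, one_apply_eq_self]
  rw [cmul, ← hy, one_mul, hx]
  refine le_of_sq_le_sq ?_ (norm_nonneg _)
  rw [← real_inner_self_eq_norm_sq, ← real_inner_self_eq_norm_sq, ← pos_symm hG,
    ← pos_symm hP, ← cmul G G, ← cmul P P, hPP, hGG]
  simp only [add_apply, smul_apply, one_apply_eq_self, inner_add_left, inner_smul_left,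
      conj_trivial, real_inner_self_eq_norm_sq]
  nlinarith [sq_nonneg ‖y‖]
end Approx

/-- Rate for estimating the correlation operator `R₀ = D^β Φ D^β` (with
`C₀ = D^{1/2} R₀ D^{1/2}`) from estimates `Ĉ₀`, `D̂` accurate to within `0 < δ ≤ 1` in
Hilbert–Schmidt norm: with `b := min(β, 1)`, the regularization choice `ε := δ^{1/(1+b)}`,
and `R̂₀ := (εI + D̂)^{−1/2} Ĉ₀ (εI + D̂)^{−1/2}`, one has
`‖R̂₀ − R₀‖₂ ≤ κ δ^{b/(1+b)}` where `κ := 8 max(1 + ‖R₀‖₂, ‖Φ‖₂ ‖D‖^{2β − b})`.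
The powers `D^r` (for `r > 0`) are given by the continuous functional calculus,
characterized by the defining properties of the positive power semigroup `Dpow`;
`(εI + D̂)^{−1/2}` is the ring inverse of the unique positive square root `Qhat` of
`εI + D̂`.  Hilbert–Schmidt norms are computed through a Hilbert basis `(eᵢ)`; `‖D‖` is
the operator norm. -/
theorem stmt_12 {E : Type*} [NormedAddCommGroup E] [InnerProductSpace ℝ E] [CompleteSpace E]
    {ι : Type*} (e : HilbertBasis ι ℝ E)
    (δ β : ℝ) (hδ0 : 0 < δ) (hδ1 : δ ≤ 1) (hβ : 0 < β)
    (D Dhat : E →L[ℝ] E) (hD : 0 ≤ D) (hDhat : 0 ≤ Dhat)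
    (hDD_HS : Summable fun i => ‖(Dhat - D) (e i)‖ ^ 2)
    (hDD : Real.sqrt (∑' i, ‖(Dhat - D) (e i)‖ ^ 2) ≤ δ)
    (Φ : E →L[ℝ] E) (hΦ_HS : Summable fun i => ‖Φ (e i)‖ ^ 2)
    -- the power semigroup `r ↦ D^r` for `r > 0`, i.e. the continuous functional calculus
    (Dpow : ℝ → E →L[ℝ] E)
    (hDpow_pos : ∀ r, 0 < r → 0 ≤ Dpow r)
    (hDpow_add : ∀ s t, 0 < s → 0 < t → Dpow (s + t) = Dpow s * Dpow t)
    (hDpow_one : Dpow 1 = D)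
    (hDpow_cont : ∀ x : E, ContinuousOn (fun r : ℝ => Dpow r x) (Set.Ioi (0 : ℝ)))
    -- `(εI + D̂)^{1/2}` with `ε := δ^{1/(1+b)}`, `b := min β 1`
    (Qhat : E →L[ℝ] E) (hQhat_pos : 0 ≤ Qhat)
    (hQhat : Qhat * Qhat =
      (δ ^ ((1 : ℝ) / (1 + min β 1))) • (1 : E →L[ℝ] E) + Dhat)
    -- the estimate `Ĉ₀` of `C₀ = D^{1/2} R₀ D^{1/2}`, `R₀ = D^β Φ D^β`
    (Chat₀ : E →L[ℝ] E)
    (hChat₀_HS : Summable fun i =>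
      ‖(Chat₀ - Dpow (1 / 2) * (Dpow β * Φ * Dpow β) * Dpow (1 / 2)) (e i)‖ ^ 2)
    (hCC : Real.sqrt (∑' i,
      ‖(Chat₀ - Dpow (1 / 2) * (Dpow β * Φ * Dpow β) * Dpow (1 / 2)) (e i)‖ ^ 2) ≤ δ) :
    Real.sqrt (∑' i,
        ‖(Ring.inverse Qhat * Chat₀ * Ring.inverse Qhat -
            Dpow β * Φ * Dpow β) (e i)‖ ^ 2) ≤
      8 * max (1 + Real.sqrt (∑' i, ‖(Dpow β * Φ * Dpow β) (e i)‖ ^ 2))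
          (Real.sqrt (∑' i, ‖Φ (e i)‖ ^ 2) * ‖D‖ ^ (2 * β - min β 1)) *
        δ ^ (min β 1 / (1 + min β 1)) := by
  obtain ⟨b, hbdef⟩ : ∃ b, b = min β 1 := ⟨_, rfl⟩
  rw [← hbdef] at hQhat ⊢
  have hb : 0 < b := by rw [hbdef]; exact lt_min hβ one_pos
  have hb1 : b ≤ 1 := by rw [hbdef]; exact min_le_right _ _
  have hbβ : b ≤ β := by rw [hbdef]; exact min_le_left _ _
  obtain ⟨ε, hεdef⟩ : ∃ ε, ε = δ ^ ((1 : ℝ) / (1 + b)) := ⟨_, rfl⟩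
  rw [← hεdef] at hQhat
  have hε : 0 < ε := by rw [hεdef]; positivity
  obtain ⟨t, htdef⟩ : ∃ t, t = δ ^ (b / (1 + b)) := ⟨_, rfl⟩
  rw [← htdef]
  have ht0 : 0 < t := by rw [htdef]; positivity
  have ht1 : t ≤ 1 := by rw [htdef]; exact Real.rpow_le_one hδ0.le hδ1 (by positivity)
  have hεb : ε ^ b = t := by
    rw [hεdef, htdef, ← Real.rpow_mul hδ0.le]; congr 1; field_simp
  have htε : t * ε = δ := by
    rw [hεdef, htdef, ← Real.rpow_add hδ0]
    have : b / (1 + b) + 1 / (1 + b) = 1 := by field_simp; ring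
    rw [this, Real.rpow_one]
  set s := Real.sqrt ε with hsdef
  have hs : 0 < s := Real.sqrt_pos.2 hε
  have hss : s * s = ε := Real.mul_self_sqrt hε.le
  have hhalf : (0 : ℝ) < 1 / 2 := by norm_num
  set G := Dpow (1 / 2) with hG
  have hGpos : 0 ≤ G := hDpow_pos _ hhalf
  have hGG : G * G = Dpow 1 := by rw [hG, ← hDpow_add _ _ hhalf hhalf]; norm_num
  have hcomm : ∀ r q, 0 < r → 0 < q → Commute (Dpow r) (Dpow q) := fun r q hr hq => by
    change Dpow r * Dpow q = Dpow q * Dpow r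
    rw [← hDpow_add _ _ hr hq, ← hDpow_add _ _ hq hr, add_comm]
  obtain ⟨P, hP, hPP, hPc'⟩ := root_exists hGpos hε
  rw [hGG] at hPP hPc'
  have hPc : ∀ r, 0 < r → Commute (Dpow r) P := fun r hr => hPc' _ (hcomm r 1 hr one_pos)
  obtain ⟨hPu, hPi, hPm⟩ := root_facts hε hP (hDpow_pos 1 one_pos) hPP
  obtain ⟨hQu, hQi, hQm⟩ := root_facts hε hQhat_pos hDhat hQhat
  rw [← hsdef] at hQi hPm hQm
  have hΔ : HSB e (Dhat - D) δ := HSB.of_summable hDD_HS hDD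
  have hPQ : ‖P - Qhat‖ ≤ δ / (2 * s) := by
    refine sylv (pos_symm hP) (pos_symm hQhat_pos) hs hPm hQm ?_
    rw [hPP, hQhat, hDpow_one]
    have : ε • (1 : E →L[ℝ] E) + D - (ε • (1 : E →L[ℝ] E) + Dhat) = -(Dhat - D) := by abel
    rw [this, norm_neg]
    exact hΔ.opNorm_le
  set Qi := Ring.inverse Qhat with hQidef
  set Pi := Ring.inverse P with hPidef
  have q1 : Qhat * Qi = 1 := Ring.mul_inverse_cancel _ hQu
  have q2 : Qi * Qhat = 1 := Ring.inverse_mul_cancel _ hQu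
  have p1 : P * Pi = 1 := Ring.mul_inverse_cancel _ hPu
  have p2 : Pi * P = 1 := Ring.inverse_mul_cancel _ hPu
  have hWn : 1 / s * (δ / (2 * s)) = t / 2 := by
    rw [← htε, ← hss]; field_simp
  have hW : ‖Qi * P - 1‖ ≤ t / 2 := by
    have : Qi * P - 1 = Qi * (P - Qhat) := by rw [mul_sub, q2]
    rw [this, ← hWn]
    exact (norm_mul_le _ _).trans (mul_le_mul hQi hPQ (norm_nonneg _) (by positivity))
  have hW' : ‖P * Qi - 1‖ ≤ t / 2 := by
    have : P * Qi - 1 = (P - Qhat) * Qi := by rw [sub_mul, q1]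
    rw [this, ← hWn, mul_comm (1 / s)]
    exact (norm_mul_le _ _).trans (mul_le_mul hPQ hQi (norm_nonneg _) (by positivity))
  have hone : ‖(1 : E →L[ℝ] E)‖ ≤ 1 := ContinuousLinearMap.norm_id_le
  have hW'2 : ‖P * Qi‖ ≤ 3 / 2 := by
    have h := norm_add_le (P * Qi - 1) 1
    rw [sub_add_cancel] at h
    linarith
  have hGPi : ‖G * Pi‖ ≤ 1 := half_bound hGpos hP hPu hε hGG hPP
  have cPi : ∀ r, 0 < r → Dpow r * Pi = Pi * Dpow r := fun r hr => by
    have h := (hPc r hr).eq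
    calc Dpow r * Pi = Pi * (P * Dpow r) * Pi := by rw [← mul_assoc, p2, one_mul]
      _ = Pi * Dpow r * (P * Pi) := by rw [← h]; simp only [mul_assoc]
      _ = _ := by rw [p1, mul_one]
  have hGP : G * Pi = Pi * G := cPi _ hhalf
  have hPiG : ‖Pi * G‖ ≤ 1 := hGP ▸ hGPi
  have hap : ‖(Pi * G - 1) * Dpow β‖ ≤ t * ‖D‖ ^ (β - b) := by
    have := approx_bound hDpow_pos hDpow_add hDpow_cont hε hP hPu hPP hPc hb hb1 hbβ
    rwa [hεb, hDpow_one] at this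
  have hap' : ‖Dpow β * (G * Pi - 1)‖ ≤ t * ‖D‖ ^ (β - b) := by
    have : Dpow β * (G * Pi - 1) = (Pi * G - 1) * Dpow β := by
      rw [hGP, mul_sub, sub_mul, mul_one, one_mul, ← mul_assoc, cPi β hβ, mul_assoc, mul_assoc,
        hG, (hcomm β (1 / 2) hβ hhalf).eq]
    rw [this]; exact hap
  have hDβ : ‖Dpow β‖ ≤ ‖D‖ ^ β := by
    have := pow_norm hDpow_pos hDpow_add hDpow_cont hβ
    rwa [hDpow_one] at this
  have hd : ‖D‖ ^ (2 * β - b) = ‖D‖ ^ (β - b) * ‖D‖ ^ β := by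
    rw [← Real.rpow_add_of_nonneg (norm_nonneg _) (sub_nonneg.2 hbβ) hβ.le]
    congr 1; ring
  -- Hilbert–Schmidt bounds
  obtain ⟨φ, hφ⟩ : ∃ φ, φ = Real.sqrt (∑' i, ‖Φ (e i)‖ ^ 2) := ⟨_, rfl⟩
  have hΦ : HSB e Φ φ := HSB.of_summable hΦ_HS hφ.ge
  obtain ⟨R, hR⟩ : ∃ R, R = Dpow β * Φ * Dpow β := ⟨_, rfl⟩
  have hR0 : HSB e R (‖D‖ ^ β * φ * ‖D‖ ^ β) := by
    rw [hR]; exact (hΦ.mul_left _ hDβ).mul_right _ hDβ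
  rw [← hR] at hChat₀_HS hCC ⊢
  obtain ⟨ρ, hρ⟩ : ∃ ρ, ρ = Real.sqrt (∑' i, ‖R (e i)‖ ^ 2) := ⟨_, rfl⟩
  have hRB : HSB e R ρ := HSB.of_summable hR0.summable hρ.ge
  have hCB : HSB e (Chat₀ - G * R * G) δ := HSB.of_summable hChat₀_HS hCC
  rw [← hφ, ← hρ]
  have t1 : HSB e (Qi * (Chat₀ - G * R * G) * Qi) (1 / s * δ * (1 / s)) :=
    (hCB.mul_left _ hQi).mul_right _ hQi
  obtain ⟨X, hX⟩ : ∃ X, X = (Pi * G) * R * (G * Pi) := ⟨_, rfl⟩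
  have hXB : HSB e X ρ := by
    have := (hRB.mul_left _ hPiG).mul_right _ hGPi
    rwa [one_mul, mul_one, ← hX] at this
  have t2 : HSB e ((Qi * P - 1) * X * (P * Qi)) (t / 2 * ρ * (3 / 2)) :=
    (hXB.mul_left _ hW).mul_right _ hW'2
  have t3 : HSB e (X * (P * Qi - 1)) (ρ * (t / 2)) := hXB.mul_right _ hW'
  have t4 : HSB e (((Pi * G - 1) * Dpow β) * Φ * Dpow β * (G * Pi))
      (t * ‖D‖ ^ (β - b) * φ * ‖D‖ ^ β * 1) :=
    ((hΦ.mul_left _ hap).mul_right _ hDβ).mul_right _ hGPi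
  have t5 : HSB e (Dpow β * Φ * (Dpow β * (G * Pi - 1)))
      (‖D‖ ^ β * φ * (t * ‖D‖ ^ (β - b))) :=
    (hΦ.mul_left _ hDβ).mul_right _ hap'
  have total := (((t1.add t2).add t3).add t4).add t5
  have heq : Qi * (Chat₀ - G * R * G) * Qi + (Qi * P - 1) * X * (P * Qi) + X * (P * Qi - 1)
      + ((Pi * G - 1) * Dpow β) * Φ * Dpow β * (G * Pi)
      + Dpow β * Φ * (Dpow β * (G * Pi - 1)) = Qi * Chat₀ * Qi - R := by
    have a1 : Qi * P * X * (P * Qi) = Qi * (G * R * G) * Qi := by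
      calc Qi * P * X * (P * Qi) = Qi * (P * Pi) * (G * R * G) * (Pi * P) * Qi := by
            rw [hX]; simp only [mul_assoc]
        _ = _ := by rw [p1, p2, mul_one, mul_one]
    have a2 : ((Pi * G - 1) * Dpow β) * Φ * Dpow β * (G * Pi) = X - R * (G * Pi) := by
      rw [hX, hR]; noncomm_ring
    have a3 : Dpow β * Φ * (Dpow β * (G * Pi - 1)) = R * (G * Pi) - R := by
      rw [hR]; noncomm_ring
    have a4 : (Qi * P - 1) * X * (P * Qi) = Qi * (G * R * G) * Qi - X * (P * Qi) := by
      rw [← a1]; noncomm_ring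
    rw [a2, a3, a4, mul_sub, sub_mul, mul_sub X, mul_one]
    abel
  rw [heq] at total
  refine total.sqrt_le.trans ?_
  have n1 : 1 / s * δ * (1 / s) = t := by rw [← htε, ← hss]; field_simp
  rw [n1, hd]
  have m1 := le_max_left (1 + ρ) (φ * (‖D‖ ^ (β - b) * ‖D‖ ^ β))
  have m2 := le_max_right (1 + ρ) (φ * (‖D‖ ^ (β - b) * ‖D‖ ^ β))
  set m := max (1 + ρ) (φ * (‖D‖ ^ (β - b) * ‖D‖ ^ β))
  have hρ0 : 0 ≤ ρ := hRB.1
  have z1 := mul_le_mul_of_nonneg_left m1 ht0.le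
  have z2 := mul_le_mul_of_nonneg_left m2 ht0.le
  have z3 : 0 ≤ t * ρ := by positivity
  nlinarith
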